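/- Let x' : ℝ²ⁿ × ℝ → ℝ²ⁿ be smooth such that (x, t) ↦ (x'(x, t), t) is a diffeomorphism of ℝ²ⁿ × ℝ. Suppose x' is a canonical transformation, i.e. for every smooth H : ℝ²ⁿ × ℝ → ℝ there exists a smooth H' : ℝ²ⁿ × ℝ → ℝ such that for all (x, t): D_x x'(x, t) · ( J ∇_x H(x, t) ) + ∂_t x'(x, t) = J (∇H')(x'(x, t), t) (every Hamiltonian time evolution is mapped to a Hamiltonian time evolution). Then there exists a nonzero constant c ∈ ℝ, independent of x and t, such that D_x x'(x, t) · J · (D_x x'(x, t))ᵀ = c·J for all (x, t); i.e. canonical transformations preserve the symplectic structure up to a constant rescaling. -/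

import Mathlib

open scoped BigOperators
open Matrix

/-- The phase space `ℝ²ⁿ`, with coordinates indexed by `Fin n ⊕ Fin n`
(positions `q^A = x (inl A)`, momenta `p_A = x (inr A)`). -/
abbrev Phase (n : ℕ) : Type := (Fin n ⊕ Fin n) → ℝ

/-- The standard symplectic matrix `J = [[0, 1], [-1, 0]]`. -/
noncomputable def stdJ (n : ℕ) : Matrix (Fin n ⊕ Fin n) (Fin n ⊕ Fin n) ℝ :=
  Matrix.fromBlocks 0 1 (-1) 0


section GradientMaps

variable {ι : Type*} [Fintype ι] [DecidableEq ι]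

theorem ContDiff.fderiv_fderiv_symm {E : Type*} [NormedAddCommGroup E] [NormedSpace ℝ E]
    {f : E → ℝ} (hf : ContDiff ℝ (⊤ : ℕ∞) f) (x u v : E) :
    fderiv ℝ (fderiv ℝ f) x u v = fderiv ℝ (fderiv ℝ f) x v u := by
  have h : IsSymmSndFDerivAt ℝ f x :=
    hf.contDiffAt.isSymmSndFDerivAt (by simpa using (WithTop.coe_le_coe.2 le_top : ((2 : ℕ∞) : WithTop ℕ∞) ≤ (⊤ : ℕ∞)))
  exact h.eq u v

theorem ContDiff.differentiable_fderiv_top {E : Type*} [NormedAddCommGroup E] [NormedSpace ℝ E]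
    {f : E → ℝ} (hf : ContDiff ℝ (⊤ : ℕ∞) f) : Differentiable ℝ (fderiv ℝ f) :=
  (hf.fderiv_right (m := (⊤ : ℕ∞)) le_rfl).differentiable (by simp)

theorem ContinuousLinearMap.ext_pi_single {F : Type*} [AddCommGroup F] [Module ℝ F]
    [TopologicalSpace F] {f g : (ι → ℝ) →L[ℝ] F}
    (h : ∀ i, f (Pi.single i 1) = g (Pi.single i 1)) : f = g := by
  apply ContinuousLinearMap.coe_injective
  apply LinearMap.pi_ext'
  intro i
  ext
  simpa using h i

theorem ContinuousLinearMap.apply_eq_sum_single {F : Type*} [AddCommGroup F] [Module ℝ F]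
    [TopologicalSpace F] (f : (ι → ℝ) →L[ℝ] F) (v : ι → ℝ) :
    f v = ∑ i, v i • f (Pi.single i 1) := by
  conv_lhs => rw [pi_eq_sum_univ' v]
  simp [map_sum]

/-- A field of matrices sending every gradient field to a gradient field is a constant multiple
of the identity, in dimension at least two. -/
theorem exists_eq_smul_one_of_maps_gradients [Nontrivial ι] (A : (ι → ℝ) → Matrix ι ι ℝ)
    (hA : ∀ h : (ι → ℝ) → ℝ, ContDiff ℝ (⊤ : ℕ∞) h →
      ∃ K : (ι → ℝ) → ℝ, ContDiff ℝ (⊤ : ℕ∞) K ∧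
        ∀ z i, ∑ j, A z i j * fderiv ℝ h z (Pi.single j 1) = fderiv ℝ K z (Pi.single i 1)) :
    ∃ c : ℝ, ∀ z, A z = c • (1 : Matrix ι ι ℝ) := by
  have hcoord (m : ι) (z : ι → ℝ) :
      HasFDerivAt (fun z : ι → ℝ => z m) (ContinuousLinearMap.proj m : (ι → ℝ) →L[ℝ] ℝ) z :=
    (ContinuousLinearMap.proj m : (ι → ℝ) →L[ℝ] ℝ).hasFDerivAt
  choose K hK hKA using fun m : ι => hA (fun z => z m) (contDiff_apply ℝ ℝ m)
  have hKA' (m z i) : A z i m = fderiv ℝ (K m) z (Pi.single i 1) := by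
    rw [← hKA m z i, (hcoord m z).fderiv]
    simp [Pi.single_apply]
  have hquad (l m : ι) (z u v : ι → ℝ) :
      u l * fderiv ℝ (K m) z v + u m * fderiv ℝ (K l) z v
        = v l * fderiv ℝ (K m) z u + v m * fderiv ℝ (K l) z u := by
    obtain ⟨Q, hQ, hQA⟩ := hA (fun z => z l * z m)
      ((contDiff_apply ℝ ℝ l).mul (contDiff_apply ℝ ℝ m))
    have hfd : fderiv ℝ Q = fun z => z l • fderiv ℝ (K m) z + z m • fderiv ℝ (K l) z := by
      funext z
      apply ContinuousLinearMap.ext_pi_single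
      intro i
      have hprod : HasFDerivAt (fun z : ι → ℝ => z l * z m) _ z := (hcoord l z).mul (hcoord m z)
      rw [← hQA z i, hprod.fderiv]
      simp [Pi.single_apply, mul_add, Finset.sum_add_distrib, ← hKA', mul_comm]
    have hd (u v : ι → ℝ) : fderiv ℝ (fderiv ℝ Q) z u v
        = z l * fderiv ℝ (fderiv ℝ (K m)) z u v + u l * fderiv ℝ (K m) z v
          + (z m * fderiv ℝ (fderiv ℝ (K l)) z u v + u m * fderiv ℝ (K l) z v) := by
      have hsum : HasFDerivAt
          (fun z : ι → ℝ => z l • fderiv ℝ (K m) z + z m • fderiv ℝ (K l) z) _ z :=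
        ((hcoord l z).smul ((hK m).differentiable_fderiv_top z).hasFDerivAt).add
          ((hcoord m z).smul ((hK l).differentiable_fderiv_top z).hasFDerivAt)
      rw [hfd, hsum.fderiv]
      simp
    have hs := hQ.fderiv_fderiv_symm z u v
    rw [hd, hd, (hK m).fderiv_fderiv_symm z u v, (hK l).fderiv_fderiv_symm z u v] at hs
    linarith
  have hdiag (m : ι) (z v : ι → ℝ) :
      fderiv ℝ (K m) z v = v m * fderiv ℝ (K m) z (Pi.single m 1) := by
    have := hquad m m z (Pi.single m 1) v
    simp only [Pi.single_eq_same] at this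
    linarith
  have heq (l m : ι) (z : ι → ℝ) :
      fderiv ℝ (K l) z (Pi.single l 1) = fderiv ℝ (K m) z (Pi.single m 1) := by
    rcases eq_or_ne l m with rfl | hlm
    · rfl
    have := hquad l m z (Pi.single l 1) (Pi.single m 1)
    rw [hdiag m z (Pi.single l 1), hdiag l z (Pi.single m 1)] at this
    simp [hlm, hlm.symm] at this
    linarith
  obtain ⟨i₀⟩ : Nonempty ι := inferInstance
  set c : (ι → ℝ) → ℝ := fun z => fderiv ℝ (K i₀) z (Pi.single i₀ 1)
  have hKc (m : ι) (z v : ι → ℝ) : fderiv ℝ (K m) z v = v m * c z := by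
    rw [hdiag, heq m i₀]
  have hcd : Differentiable ℝ c := fun z =>
    ((hK i₀).differentiable_fderiv_top z).clm_apply (differentiableAt_const _)
  have hKm (m : ι) (z u v : ι → ℝ) : fderiv ℝ (fderiv ℝ (K m)) z u v = v m * fderiv ℝ c z u := by
    have h₁ : fderiv ℝ (fun z => fderiv ℝ (K m) z v) z u = fderiv ℝ (fderiv ℝ (K m)) z u v := by
      rw [fderiv_clm_apply ((hK m).differentiable_fderiv_top z) (differentiableAt_const _)]
      simp
    rw [← h₁]
    simp_rw [hKc m _ v]
    rw [fderiv_const_mul (hcd z)]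
    simp
  have hc0 (z : ι → ℝ) : fderiv ℝ c z = 0 := by
    apply ContinuousLinearMap.ext_pi_single
    intro k
    obtain ⟨m, hm⟩ := exists_ne k
    have := (hK m).fderiv_fderiv_symm z (Pi.single k 1) (Pi.single m 1)
    rw [hKm, hKm] at this
    simpa [hm] using this
  refine ⟨c 0, fun z => ?_⟩
  ext i m
  rw [hKA', hKc, is_const_of_fderiv_eq_zero hcd hc0 z 0]
  simp [Matrix.one_apply, Pi.single_apply, eq_comm]

end GradientMaps

/-- Differentiation in the second variable commutes with differentiation in the first one. -/
theorem hasDerivAt_fderiv_partial {E : Type*} [NormedAddCommGroup E] [NormedSpace ℝ E]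
    {f : E × ℝ → ℝ} (hf : ContDiff ℝ (⊤ : ℕ∞) f) (x v : E) (t : ℝ) :
    HasDerivAt (fun s => fderiv ℝ (fun z => f (z, s)) x v)
      (fderiv ℝ (fun z => deriv (fun s => f (z, s)) t) x v) t := by
  have hfd : Differentiable ℝ f := hf.differentiable (by simp)
  have hl (z : E) (s : ℝ) : HasFDerivAt (fun z : E => (z, s)) (ContinuousLinearMap.inl ℝ E ℝ) z :=
    hasFDerivAt_prodMk_left z s
  have hr (z : E) (s : ℝ) : HasDerivAt (fun s : ℝ => (z, s)) ((0, 1) : E × ℝ) s :=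
    (hasDerivAt_const s z).prodMk (hasDerivAt_id s)
  have h₁ (s : ℝ) : fderiv ℝ (fun z => f (z, s)) x v = fderiv ℝ f (x, s) (v, 0) := by
    have h : HasFDerivAt (fun z => f (z, s)) _ x := (hfd (x, s)).hasFDerivAt.comp x (hl x s)
    rw [h.fderiv]
    simp
  have h₂ (z : E) : deriv (fun s => f (z, s)) t = fderiv ℝ f (z, t) (0, 1) :=
    ((hfd (z, t)).hasFDerivAt.comp_hasDerivAt t (hr z t)).deriv
  have hD := (hf.differentiable_fderiv_top (x, t)).hasFDerivAt
  have h₃ : fderiv ℝ (fun z => fderiv ℝ f (z, t) (0, 1)) x v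
      = fderiv ℝ (fderiv ℝ f) (x, t) (v, 0) (0, 1) := by
    have h : HasFDerivAt (fun z => fderiv ℝ f (z, t) (0, 1)) _ x :=
      (hD.comp x (hl x t)).clm_apply (hasFDerivAt_const ((0, 1) : E × ℝ) x)
    rw [h.fderiv]
    simp
  simp_rw [h₁, h₂]
  rw [h₃, hf.fderiv_fderiv_symm]
  simpa using (hD.comp_hasDerivAt t (hr x t)).clm_apply (hasDerivAt_const t ((v, 0) : E × ℝ))

theorem stdJ_mul_self (n : ℕ) : stdJ n * stdJ n = -1 := by
  simp [stdJ, Matrix.fromBlocks_multiply, ← Matrix.fromBlocks_one, Matrix.fromBlocks_neg]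

theorem stdJ_transpose (n : ℕ) : (stdJ n)ᵀ = -stdJ n := by
  simp [stdJ, Matrix.fromBlocks_transpose, Matrix.fromBlocks_neg]

section CoordinateDerivatives

variable {ι κ : Type*} [Fintype ι] [DecidableEq ι] [Fintype κ]

/-- The chain rule in coordinates. -/
theorem fderiv_comp_eq_sum {E : Type*} [NormedAddCommGroup E] [NormedSpace ℝ E]
    {h : (ι → ℝ) → ℝ} {F : E → ι → ℝ} {x : E}
    (hh : DifferentiableAt ℝ h (F x)) (hF : DifferentiableAt ℝ F x) (v : E) :
    fderiv ℝ (fun z => h (F z)) x v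
      = ∑ k, fderiv ℝ h (F x) (Pi.single k 1) * fderiv ℝ (fun z => F z k) x v := by
  have hc : HasFDerivAt (fun z => h (F z)) _ x := hh.hasFDerivAt.comp x hF.hasFDerivAt
  rw [hc.fderiv, ContinuousLinearMap.comp_apply, ContinuousLinearMap.apply_eq_sum_single]
  refine Finset.sum_congr rfl fun k _ => ?_
  rw [fderiv_apply hF k]
  simp [mul_comm]

theorem hasDerivAt_matrix_mul_apply {m p : Type*} {A : ℝ → Matrix m κ ℝ} {B : ℝ → Matrix κ p ℝ}
    {A' : Matrix m κ ℝ} {B' : Matrix κ p ℝ} {t : ℝ}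
    (hA : ∀ i j, HasDerivAt (fun s => A s i j) (A' i j) t)
    (hB : ∀ i j, HasDerivAt (fun s => B s i j) (B' i j) t) (i : m) (j : p) :
    HasDerivAt (fun s => (A s * B s) i j) ((A' * B t + A t * B') i j) t := by
  simp only [Matrix.mul_apply, Matrix.add_apply, ← Finset.sum_add_distrib]
  exact HasDerivAt.fun_sum fun k _ => (hA i k).mul (hB k j)

end CoordinateDerivatives

/-- A canonical transformation (a time-dependent change of coordinates mapping every
Hamiltonian time evolution to a Hamiltonian time evolution) preserves the symplectic
structure up to a constant rescaling: `D_x x' · J · (D_x x')ᵀ = c·J` for some nonzero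
constant `c` independent of `x` and `t`. -/
theorem canonical_transformation_symplectic_up_to_constant (n : ℕ)
    (x' : Phase n × ℝ → Phase n) (hx' : ContDiff ℝ (⊤ : ℕ∞) x')
    (y : Phase n × ℝ → Phase n) (hy : ContDiff ℝ (⊤ : ℕ∞) y)
    (hinv₁ : ∀ (x : Phase n) (t : ℝ), y (x' (x, t), t) = x)
    (hinv₂ : ∀ (x : Phase n) (t : ℝ), x' (y (x, t), t) = x)
    (hcanon : ∀ H : Phase n × ℝ → ℝ, ContDiff ℝ (⊤ : ℕ∞) H →
      ∃ H' : Phase n × ℝ → ℝ, ContDiff ℝ (⊤ : ℕ∞) H' ∧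
        ∀ (x : Phase n) (t : ℝ) (i : Fin n ⊕ Fin n),
          (∑ j, fderiv ℝ (fun z => x' (z, t) i) x (Pi.single j 1)
              * (∑ k, stdJ n j k * fderiv ℝ (fun z => H (z, t)) x (Pi.single k 1)))
            + deriv (fun s => x' (x, s) i) t
          = ∑ j, stdJ n i j
              * fderiv ℝ (fun z => H' (z, t)) (x' (x, t)) (Pi.single j 1)) :
    ∃ c : ℝ, c ≠ 0 ∧ ∀ (x : Phase n) (t : ℝ),
      (Matrix.of fun i j => fderiv ℝ (fun z => x' (z, t) i) x (Pi.single j 1))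
          * stdJ n
          * (Matrix.of fun i j => fderiv ℝ (fun z => x' (z, t) i) x (Pi.single j 1))ᵀ
        = c • stdJ n := by
  rcases Nat.eq_zero_or_pos n with rfl | hn
  · exact ⟨1, one_ne_zero, fun x t => Subsingleton.elim _ _⟩
  have : Nontrivial (Fin n ⊕ Fin n) := ⟨Sum.inl ⟨0, hn⟩, Sum.inr ⟨0, hn⟩, by simp⟩
  set L : Phase n → ℝ → Matrix (Fin n ⊕ Fin n) (Fin n ⊕ Fin n) ℝ := fun x t =>
    Matrix.of fun i j => fderiv ℝ (fun z => x' (z, t) i) x (Pi.single j 1)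
  change ∃ c : ℝ, c ≠ 0 ∧ ∀ (x : Phase n) (t : ℝ), L x t * stdJ n * (L x t)ᵀ = c • stdJ n
  have hslice (t : ℝ) : ContDiff ℝ (⊤ : ℕ∞) fun z : Phase n => (z, t) :=
    contDiff_id.prodMk contDiff_const
  have hx't (t : ℝ) : Differentiable ℝ fun z : Phase n => x' (z, t) :=
    (hx'.comp (hslice t)).differentiable (by simp)
  have hyt (t : ℝ) : Differentiable ℝ fun z : Phase n => y (z, t) :=
    (hy.comp (hslice t)).differentiable (by simp)
  obtain ⟨K₀, hK₀, hK₀'⟩ := hcanon (fun _ => 0) contDiff_const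
  have hvel (x : Phase n) (t : ℝ) (i : Fin n ⊕ Fin n) : deriv (fun s => x' (x, s) i) t
      = ∑ j, stdJ n i j * fderiv ℝ (fun z => K₀ (z, t)) (x' (x, t)) (Pi.single j 1) := by
    simpa using hK₀' x t i
  have hscalar (t : ℝ) : ∃ c : ℝ, ∀ z : Phase n,
      -(stdJ n * (L (y (z, t)) t * stdJ n * (L (y (z, t)) t)ᵀ)) = c • 1 := by
    apply exists_eq_smul_one_of_maps_gradients
    intro h hh
    obtain ⟨K, hK, hK'⟩ := hcanon (fun p => h (x' p)) (hh.comp hx')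
    refine ⟨fun z => K (z, t) - K₀ (z, t),
      (hK.comp (hslice t)).sub (hK₀.comp (hslice t)), fun z i => ?_⟩
    set g : Phase n → Phase n := fun z j => fderiv ℝ h z (Pi.single j 1)
    set k : Phase n → Phase n := fun z j =>
      fderiv ℝ (fun z => K (z, t) - K₀ (z, t)) z (Pi.single j 1) with hk
    have hvec : L (y (z, t)) t *ᵥ (stdJ n *ᵥ ((L (y (z, t)) t)ᵀ *ᵥ g z)) = stdJ n *ᵥ k z := by
      ext i
      have h₁ := hK' (y (z, t)) t i
      rw [hvel, hinv₂] at h₁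
      have hgrad (j : Fin n ⊕ Fin n) :
          fderiv ℝ (fun z => h (x' (z, t))) (y (z, t)) (Pi.single j 1)
            = ((L (y (z, t)) t)ᵀ *ᵥ g z) j := by
        rw [fderiv_comp_eq_sum (hh.differentiable (by simp) _) (hx't t _), hinv₂]
        exact Finset.sum_congr rfl fun k _ => mul_comm _ _
      have hsub (j : Fin n ⊕ Fin n) : k z j
          = fderiv ℝ (fun z => K (z, t)) z (Pi.single j 1)
            - fderiv ℝ (fun z => K₀ (z, t)) z (Pi.single j 1) := by
        simp only [hk]
        have hd : HasFDerivAt (fun z => K (z, t) - K₀ (z, t)) _ z :=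
          ((hK.comp (hslice t)).differentiable (by simp) z).hasFDerivAt.sub
            ((hK₀.comp (hslice t)).differentiable (by simp) z).hasFDerivAt
        rw [hd.fderiv]
        rfl
      simp only [hgrad] at h₁
      have h₂ : (stdJ n *ᵥ k z) i = ∑ j, stdJ n i j * k z j := rfl
      simp only [h₂, hsub, mul_sub, Finset.sum_sub_distrib]
      exact eq_sub_of_add_eq h₁
    have hfin : (-(stdJ n * (L (y (z, t)) t * stdJ n * (L (y (z, t)) t)ᵀ))) *ᵥ g z = k z := by
      rw [Matrix.neg_mulVec, ← Matrix.mulVec_mulVec, ← Matrix.mulVec_mulVec,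
        ← Matrix.mulVec_mulVec, hvec, Matrix.mulVec_mulVec, stdJ_mul_self,
        Matrix.neg_mulVec, Matrix.one_mulVec, neg_neg]
    exact congrFun hfin i
  choose c hc using hscalar
  have hM (x : Phase n) (t : ℝ) : L x t * stdJ n * (L x t)ᵀ = c t • stdJ n := by
    have h := congrArg (stdJ n * ·) (hc t (x' (x, t)))
    simp only [hinv₁, Matrix.mul_neg, ← Matrix.mul_assoc, stdJ_mul_self] at h
    simpa [Matrix.mul_assoc] using h
  have hL' (x : Phase n) (t : ℝ) : ∃ S : Matrix (Fin n ⊕ Fin n) (Fin n ⊕ Fin n) ℝ, Sᵀ = S ∧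
      ∀ i j, HasDerivAt (fun s => L x s i j) ((stdJ n * S * L x t) i j) t := by
    have hKt : ContDiff ℝ (⊤ : ℕ∞) fun z => K₀ (z, t) := hK₀.comp (hslice t)
    refine ⟨Matrix.of fun i j => fderiv ℝ (fderiv ℝ fun z => K₀ (z, t)) (x' (x, t))
      (Pi.single i 1) (Pi.single j 1), ?_, fun i j => ?_⟩
    · ext i j
      exact hKt.fderiv_fderiv_symm _ _ _
    have hfi : ContDiff ℝ (⊤ : ℕ∞) fun p => x' p i := contDiff_pi.1 hx' i
    refine HasDerivAt.congr_deriv (hasDerivAt_fderiv_partial hfi x (Pi.single j 1) t) ?_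
    simp only [hvel]
    have hV (z v : Phase n) : HasFDerivAt (fun z => fderiv ℝ (fun z => K₀ (z, t)) z v)
        ((fderiv ℝ (fderiv ℝ fun z => K₀ (z, t)) z).flip v) z := by
      simpa using
        (hKt.differentiable_fderiv_top z).hasFDerivAt.clm_apply (hasFDerivAt_const v z)
    have hW (z : Phase n) := HasFDerivAt.fun_sum (u := Finset.univ)
      fun j _ => (hV z (Pi.single j 1)).const_mul (stdJ n i j)
    refine (fderiv_comp_eq_sum (F := fun z => x' (z, t)) (hW (x' (x, t))).differentiableAt
      (hx't t x) (Pi.single j 1)).trans ?_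
    rw [Matrix.mul_apply]
    refine Finset.sum_congr rfl fun k _ => ?_
    rw [(hW _).fderiv]
    congr 1
    simp only [Matrix.mul_apply, _root_.sum_apply, _root_.smul_apply,
      ContinuousLinearMap.flip_apply, Matrix.of_apply, smul_eq_mul]
    exact Finset.sum_congr rfl fun l _ => by rw [hKt.fderiv_fderiv_symm]
  have hJ01 : stdJ n (Sum.inl ⟨0, hn⟩) (Sum.inr ⟨0, hn⟩) = 1 := by simp [stdJ]
  have hc' (t : ℝ) : HasDerivAt c 0 t := by
    obtain ⟨S, hS, hLS⟩ := hL' 0 t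
    have h₁ := hasDerivAt_matrix_mul_apply
      (hasDerivAt_matrix_mul_apply hLS (B := fun _ => stdJ n) (B' := 0)
        fun i j => hasDerivAt_const t _)
      (B := fun s => (L 0 s)ᵀ) (B' := (stdJ n * S * L 0 t)ᵀ) (fun i j => hLS j i)
      (Sum.inl ⟨0, hn⟩) (Sum.inr ⟨0, hn⟩)
    have h₂ : (stdJ n * S * L 0 t * stdJ n + L 0 t * 0) * (L 0 t)ᵀ
        + L 0 t * stdJ n * (stdJ n * S * L 0 t)ᵀ = 0 := by
      calc _ = stdJ n * S * (L 0 t * stdJ n * (L 0 t)ᵀ)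
            + (L 0 t * stdJ n * (L 0 t)ᵀ) * (S * (stdJ n)ᵀ) := by
            simp [Matrix.mul_assoc, hS]
        _ = 0 := by
            rw [hM, stdJ_transpose]
            simp [Matrix.mul_assoc]
    simp only [h₂, hM] at h₁
    simpa [hJ01] using h₁
  have hconst (t : ℝ) : c t = c 0 :=
    is_const_of_deriv_eq_zero (fun t => (hc' t).differentiableAt) (fun t => (hc' t).deriv) t 0
  refine ⟨c 0, fun h0 => ?_, fun x t => by rw [hM, hconst]⟩
  set P : Matrix (Fin n ⊕ Fin n) (Fin n ⊕ Fin n) ℝ :=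
    Matrix.of fun i j => fderiv ℝ (fun z => y (z, 0) i) (x' (0, 0)) (Pi.single j 1)
  have hPL : P * L 0 0 = 1 := by
    ext i j
    rw [Matrix.mul_apply]
    have h₁ := fderiv_comp_eq_sum (h := fun z => y (z, 0) i) (F := fun z => x' (z, 0))
      (differentiableAt_pi.1 (hyt 0 (x' (0, 0))) i) (hx't 0 0) (Pi.single j 1)
    refine h₁.symm.trans ?_
    simp_rw [hinv₁]
    have h₂ : HasFDerivAt (fun z : Phase n => z i) (ContinuousLinearMap.proj i) 0 :=
      (ContinuousLinearMap.proj i : Phase n →L[ℝ] ℝ).hasFDerivAt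
    rw [h₂.fderiv]
    simp [Matrix.one_apply, Pi.single_apply]
  have h₁ : P * (L 0 0 * stdJ n * (L 0 0)ᵀ) * Pᵀ = stdJ n := by
    calc _ = (P * L 0 0) * stdJ n * (P * L 0 0)ᵀ := by simp [Matrix.mul_assoc]
      _ = stdJ n := by simp [hPL]
  rw [hM, h0] at h₁
  have h₂ := congrFun (congrFun h₁ (Sum.inl ⟨0, hn⟩)) (Sum.inr ⟨0, hn⟩)
  rw [hJ01] at h₂
  simp at h₂
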